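/- F(2/5) − F(1) = ½·Li₂(4/5) − π²/5 + log²(2·sin(π/5)) + log²(2·sin(2π/5)) + log(2)·log(2/5). -/

import Mathlib

open Real

/-- The digamma function ψ = Γ′/Γ. -/
noncomputable def digamma (x : ℝ) : ℝ := deriv Real.Gamma x / Real.Gamma x

/-- The Herglotz function F(x) = ∑_{n≥1} (ψ(nx) − log(nx))/n. -/
noncomputable def herglotzF (x : ℝ) : ℝ :=
  ∑' n : ℕ, (digamma (((n : ℝ) + 1) * x) - Real.log (((n : ℝ) + 1) * x)) / ((n : ℝ) + 1)

/-- The dilogarithm Li₂(x) = ∑_{n≥1} xⁿ/n². -/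
noncomputable def Li2 (x : ℝ) : ℝ := ∑' n : ℕ, x ^ (n + 1) / ((n : ℝ) + 1) ^ 2


theorem summable_one_div_succ_sq : Summable fun n : ℕ => 1 / ((n : ℝ) + 1) ^ 2 := by
  have := (summable_nat_add_iff 1).2 (Real.summable_one_div_nat_pow.2 (one_lt_two))
  simpa using this

theorem hasDerivAt_log_Gamma {x : ℝ} (hx : 0 < x) :
    HasDerivAt (fun y => Real.log (Real.Gamma y)) (digamma x) x := by
  have h1 : DifferentiableAt ℝ Real.Gamma x :=
    Real.differentiableAt_Gamma fun m => by
      have : (0 : ℝ) ≤ m := m.cast_nonneg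
      linarith
  exact h1.hasDerivAt.log (Real.Gamma_pos_of_pos hx).ne'

theorem log_Gamma_add_one {x : ℝ} (hx : 0 < x) :
    Real.log (Real.Gamma (x + 1)) = Real.log x + Real.log (Real.Gamma x) := by
  rw [Real.Gamma_add_one hx.ne', Real.log_mul hx.ne' (Real.Gamma_pos_of_pos hx).ne']

theorem digamma_add_one {x : ℝ} (hx : 0 < x) : digamma (x + 1) = digamma x + 1 / x := by
  have h1 : HasDerivAt (fun y => Real.log (Real.Gamma (y + 1))) (digamma (x + 1)) x :=
    (hasDerivAt_log_Gamma (by linarith : 0 < x + 1)).comp_add_const x 1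
  have h2 : HasDerivAt (fun y => Real.log y + Real.log (Real.Gamma y)) (1 / x + digamma x) x := by
    rw [one_div]
    exact (Real.hasDerivAt_log hx.ne').add (hasDerivAt_log_Gamma hx)
  have h3 : (fun y => Real.log (Real.Gamma (y + 1))) =ᶠ[nhds x]
      fun y => Real.log y + Real.log (Real.Gamma y) := by
    filter_upwards [lt_mem_nhds hx] with y hy using log_Gamma_add_one hy
  rw [h1.unique (h2.congr_of_eventuallyEq h3), add_comm]

theorem digamma_add_nat {x : ℝ} (hx : 0 < x) (N : ℕ) :
    digamma (x + N) = digamma x + ∑ k ∈ Finset.range N, 1 / (x + k) := by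
  induction N with
  | zero => simp
  | succ N ih =>
    rw [Finset.sum_range_succ, ← add_assoc, ← ih, ← digamma_add_one (by positivity)]
    push_cast
    ring_nf

theorem digamma_le_log {x : ℝ} (hx : 0 < x) : digamma x ≤ Real.log x := by
  have h := Real.convexOn_log_Gamma.le_slope_of_hasDerivAt (x := x) (y := x + 1)
    (Set.mem_Ioi.2 hx) (Set.mem_Ioi.2 (by linarith)) (by linarith) (hasDerivAt_log_Gamma hx)
  simp only [slope_def_field, Function.comp, log_Gamma_add_one hx] at h
  simpa using h

theorem log_le_digamma_add_one {x : ℝ} (hx : 0 < x) : Real.log x ≤ digamma (x + 1) := by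
  have h := Real.convexOn_log_Gamma.slope_le_of_hasDerivAt (x := x) (y := x + 1)
    (Set.mem_Ioi.2 hx) (Set.mem_Ioi.2 (by linarith)) (by linarith)
    (hasDerivAt_log_Gamma (by linarith))
  simp only [slope_def_field, Function.comp, log_Gamma_add_one hx] at h
  simpa using h

theorem abs_digamma_sub_log_le {x : ℝ} (hx : 0 < x) : |digamma x - Real.log x| ≤ 1 / x := by
  have h1 := digamma_le_log hx
  have h2 := log_le_digamma_add_one hx
  rw [digamma_add_one hx] at h2
  have : 0 < 1 / x := by positivity
  rw [abs_le]
  constructor <;> linarith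

theorem summable_herglotzF {x : ℝ} (hx : 0 < x) :
    Summable fun n : ℕ =>
      (digamma (((n : ℝ) + 1) * x) - Real.log (((n : ℝ) + 1) * x)) / ((n : ℝ) + 1) := by
  have h2 : Summable fun n : ℕ => 1 / x * (1 / ((n : ℝ) + 1) ^ 2) :=
    summable_one_div_succ_sq.mul_left _
  refine Summable.of_norm_bounded h2 fun n => ?_
  have h := abs_digamma_sub_log_le (x := ((n : ℝ) + 1) * x) (by positivity)
  rw [norm_div, Real.norm_eq_abs, Real.norm_of_nonneg (by positivity : (0 : ℝ) ≤ n + 1)]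
  calc _ ≤ (1 / (((n : ℝ) + 1) * x)) / ((n : ℝ) + 1) := by gcongr
    _ = _ := by field_simp

theorem continuousOn_Li2 : ContinuousOn Li2 (Set.Icc 0 1) := by
  refine continuousOn_tsum (fun n => by fun_prop) summable_one_div_succ_sq fun n x hx => ?_
  rw [Real.norm_of_nonneg (div_nonneg (pow_nonneg hx.1 _) (by positivity))]
  gcongr
  exact pow_le_one₀ hx.1 hx.2

theorem Li2_zero : Li2 0 = 0 := by simp [Li2]

theorem Li2_one : Li2 1 = Real.pi ^ 2 / 6 := by
  have h := (hasSum_nat_add_iff' 1).2 hasSum_zeta_two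
  simp only [Finset.range_one, Finset.sum_singleton] at h
  unfold Li2
  rw [← (by simpa using h : HasSum (fun n : ℕ => (((n : ℝ) + 1) ^ 2)⁻¹) (Real.pi ^ 2 / 6)).tsum_eq]
  simp

theorem hasDerivAt_Li2 {x : ℝ} (h0 : 0 < x) (h1 : x < 1) :
    HasDerivAt Li2 (-Real.log (1 - x) / x) x := by
  have hs : HasSum (fun n : ℕ => x ^ n / ((n : ℝ) + 1)) (-Real.log (1 - x) / x) := by
    have := (Real.hasSum_pow_div_log_of_abs_lt_one (by rwa [abs_of_pos h0])).div_const x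
    have e : ∀ n : ℕ, x ^ (n + 1) / ((n : ℝ) + 1) / x = x ^ n / ((n : ℝ) + 1) := fun n => by
      rw [pow_succ]
      field_simp
    simpa only [e] using this
  rw [← hs.tsum_eq]
  have hr0 : 0 ≤ (1 + x) / 2 := by linarith
  refine hasDerivAt_tsum_of_isPreconnected (t := Set.Ioo 0 ((1 + x) / 2))
    (u := fun n => ((1 + x) / 2) ^ n) (y₀ := x)
    (g := fun (n : ℕ) (x : ℝ) => x ^ (n + 1) / ((n : ℝ) + 1) ^ 2)
    (g' := fun (n : ℕ) (x : ℝ) => x ^ n / ((n : ℝ) + 1))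
    (summable_geometric_of_lt_one hr0 (by linarith)) isOpen_Ioo isPreconnected_Ioo
    (fun n y _ => ?_) (fun n y hy => ?_) ⟨h0, by linarith⟩ ?_ ⟨h0, by linarith⟩
  · refine ((hasDerivAt_pow (n + 1) y).div_const (((n : ℝ) + 1) ^ 2)).congr_deriv ?_
    push_cast
    field_simp
  · rw [Real.norm_of_nonneg (div_nonneg (pow_nonneg hy.1.le _) (by positivity))]
    calc y ^ n / ((n : ℝ) + 1) ≤ y ^ n / 1 := by
          gcongr
          · exact pow_nonneg hy.1.le n
          · simp
      _ ≤ _ := by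
          rw [div_one]
          exact pow_le_pow_left₀ hy.1.le hy.2.le n
  · refine Summable.of_norm_bounded summable_one_div_succ_sq fun n => ?_
    rw [Real.norm_of_nonneg (by positivity)]
    gcongr
    exact pow_le_one₀ h0.le h1.le

theorem eq_of_hasDerivAt_zero_Ioo {f : ℝ → ℝ} {a b : ℝ} (hab : a ≤ b)
    (hc : ContinuousOn f (Set.Icc a b)) (hd : ∀ x ∈ Set.Ioo a b, HasDerivAt f 0 x) :
    f a = f b := by
  rcases hab.eq_or_lt with rfl | h
  · rfl
  obtain ⟨c, _, hc'⟩ := exists_hasDerivAt_eq_slope f (fun _ => 0) h hc hd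
  have : b - a ≠ 0 := by linarith
  field_simp at hc'
  linarith

theorem continuousAt_log_mul_log_one_sub_zero :
    ContinuousAt (fun z : ℝ => Real.log z * Real.log (1 - z)) 0 := by
  have h1 : ContinuousAt (dslope (fun z : ℝ => Real.log (1 - z)) 0) 0 := by
    rw [continuousAt_dslope_same]
    exact ((differentiableAt_const _).sub differentiableAt_id).log (by simp)
  have h2 := Real.continuous_mul_log.continuousAt.mul h1
  refine h2.congr (Filter.Eventually.of_forall fun z => ?_)
  rcases eq_or_ne z 0 with rfl | hz
  · simp
  · rw [Pi.mul_apply, dslope_of_ne _ hz, slope_def_field]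
    simp
    field_simp

theorem Li2_add_Li2_one_sub {x : ℝ} (h0 : 0 < x) (h1 : x < 1) :
    Li2 x + Li2 (1 - x) = Real.pi ^ 2 / 6 - Real.log x * Real.log (1 - x) := by
  have h := eq_of_hasDerivAt_zero_Ioo
    (f := fun z => Li2 z + Li2 (1 - z) + Real.log z * Real.log (1 - z)) h0.le ?_ ?_
  · simp only [Li2_zero, sub_zero, Li2_one, Real.log_zero, zero_mul] at h
    linarith
  · refine ContinuousOn.add (ContinuousOn.add ?_ ?_) ?_
    · exact continuousOn_Li2.mono (Set.Icc_subset_Icc le_rfl h1.le)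
    · refine continuousOn_Li2.comp (by fun_prop) fun z hz => ?_
      constructor <;> linarith [hz.1, hz.2]
    · intro z hz
      rcases hz.1.eq_or_lt with rfl | hz0
      · exact continuousAt_log_mul_log_one_sub_zero.continuousWithinAt
      · have : 1 - z ≠ 0 := by linarith [hz.2]
        refine ContinuousAt.continuousWithinAt ?_
        exact (Real.continuousAt_log hz0.ne').mul
          (ContinuousAt.log (by fun_prop) this)
  · intro z hz
    have hz1 : 0 < 1 - z := by linarith [hz.2]
    have hz0 := hz.1
    have hd : HasDerivAt (fun z : ℝ => 1 - z) (-1) z := (hasDerivAt_id z).const_sub 1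
    have := ((hasDerivAt_Li2 hz.1 (by linarith)).add
      ((hasDerivAt_Li2 hz1 (by linarith)).comp z hd)).add
      ((Real.hasDerivAt_log hz.1.ne').mul (hd.log hz1.ne'))
    refine this.congr_deriv ?_
    rw [sub_sub_cancel]
    field_simp
    ring

/-- The five-term relation for the dilogarithm. -/
theorem Li2_five_term {p q : ℝ} (hp0 : 0 ≤ p) (hp1 : p < 1) (hq0 : 0 < q) (hq1 : q < 1) :
    Li2 p + Li2 q - Li2 (p * q) = Li2 (p * (1 - q) / (1 - p * q)) +
      Li2 (q * (1 - p) / (1 - p * q)) +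
      (Real.log (1 - p) - Real.log (1 - p * q)) * (Real.log (1 - q) - Real.log (1 - p * q)) := by
  have key : ∀ z, 0 ≤ z → z ≤ p → 0 < 1 - z * q := fun z hz hzp => by nlinarith
  have h := eq_of_hasDerivAt_zero_Ioo
    (f := fun z => Li2 z - Li2 (z * q) - Li2 (z * (1 - q) / (1 - z * q)) -
      Li2 (q * (1 - z) / (1 - z * q)) -
      (Real.log (1 - z) - Real.log (1 - z * q)) *
        (Real.log (1 - q) - Real.log (1 - z * q))) hp0 ?_ ?_
  · simp only [Li2_zero, sub_zero, zero_mul, Real.log_one, mul_one, div_one] at h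
    linarith
  · have hne : ∀ z ∈ Set.Icc 0 p, 1 - z * q ≠ 0 := fun z hz => (key z hz.1 hz.2).ne'
    have hne' : ∀ z ∈ Set.Icc 0 p, 1 - z ≠ 0 := fun z hz => by linarith [hz.2]
    refine ContinuousOn.sub (ContinuousOn.sub (ContinuousOn.sub (ContinuousOn.sub ?_ ?_) ?_) ?_) ?_
    · exact continuousOn_Li2.mono (Set.Icc_subset_Icc le_rfl hp1.le)
    · refine continuousOn_Li2.comp (by fun_prop) fun z hz => ⟨mul_nonneg hz.1 hq0.le, ?_⟩
      linarith [key z hz.1 hz.2]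
    · refine continuousOn_Li2.comp (ContinuousOn.div (by fun_prop) (by fun_prop) hne)
        fun z hz => ?_
      have := key z hz.1 hz.2
      have h1 := hz.1
      have h2 : 0 ≤ 1 - q := by linarith
      refine ⟨by positivity, ?_⟩
      rw [div_le_one this]
      nlinarith [hz.2]
    · refine continuousOn_Li2.comp (ContinuousOn.div (by fun_prop) (by fun_prop) hne)
        fun z hz => ?_
      have := key z hz.1 hz.2
      have h1 := hz.1
      have h2 : 0 ≤ 1 - z := by linarith [hz.2]
      refine ⟨by positivity, ?_⟩
      rw [div_le_one this]
      nlinarith [hz.2]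
    · have h3 : ContinuousOn (fun z => Real.log (1 - z * q)) (Set.Icc 0 p) :=
        ContinuousOn.log (by fun_prop) hne
      have h4 : ContinuousOn (fun z => Real.log (1 - z)) (Set.Icc 0 p) :=
        ContinuousOn.log (by fun_prop) hne'
      fun_prop
  · intro z hz
    have hz0 := hz.1
    have hk := key z hz.1.le hz.2.le
    have hz1 : 0 < 1 - z := by linarith [hz.2]
    have hq' : 0 < 1 - q := by linarith
    have e1 : 1 - z * (1 - q) / (1 - z * q) = (1 - z) / (1 - z * q) := by
      rw [eq_div_iff hk.ne', sub_mul, div_mul_cancel₀ _ hk.ne']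
      ring
    have e2 : 1 - q * (1 - z) / (1 - z * q) = (1 - q) / (1 - z * q) := by
      rw [eq_div_iff hk.ne', sub_mul, div_mul_cancel₀ _ hk.ne']
      ring
    have p1 : 0 < (1 - z) / (1 - z * q) := by positivity
    have p2 : 0 < (1 - q) / (1 - z * q) := by positivity
    have d0 : HasDerivAt (fun z : ℝ => z * q) q z := by
      simpa using (hasDerivAt_id z).mul_const q
    have d1 : HasDerivAt (fun z : ℝ => 1 - z * q) (-q) z := d0.const_sub 1
    have d2 : HasDerivAt (fun z : ℝ => 1 - z) (-1) z := (hasDerivAt_id z).const_sub 1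
    have d3 : HasDerivAt (fun z : ℝ => z * (1 - q) / (1 - z * q))
        ((1 - q) / (1 - z * q) ^ 2) z := by
      refine (((hasDerivAt_id z).mul_const (1 - q)).div d1 hk.ne').congr_deriv ?_
      simp only [id]
      congr 1
      ring
    have d4 : HasDerivAt (fun z : ℝ => q * (1 - z) / (1 - z * q))
        (-q * (1 - q) / (1 - z * q) ^ 2) z := by
      refine ((d2.const_mul q).div d1 hk.ne').congr_deriv ?_
      congr 1
      ring
    have l0 := hasDerivAt_Li2 hz0 (by linarith)
    have l1 := (hasDerivAt_Li2 (mul_pos hz0 hq0) (by linarith)).comp z d0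
    have l2 := (hasDerivAt_Li2 (x := z * (1 - q) / (1 - z * q)) (by positivity)
      (by linarith)).comp z d3
    have l3 := (hasDerivAt_Li2 (x := q * (1 - z) / (1 - z * q)) (by positivity)
      (by linarith)).comp z d4
    have l4 := ((d2.log hz1.ne').sub (d1.log hk.ne')).mul
      ((d1.log hk.ne').const_sub (Real.log (1 - q)))
    refine ((((l0.sub l1).sub l2).sub l3).sub l4).congr_deriv ?_
    rw [e1, e2, Real.log_div hz1.ne' hk.ne', Real.log_div hq'.ne' hk.ne']
    simp only [Pi.sub_apply]
    field_simp
    ring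

/-- The function `(5 / (1 - u ^ 5) - 2 / (1 - u ^ 2))` with its removable singularity at `1`
filled in. -/
noncomputable def kernelTwoFifths (u : ℝ) : ℝ :=
  (3 + 6 * u + 4 * u ^ 2 + 2 * u ^ 3) / ((1 + u) * (1 + u + u ^ 2 + u ^ 3 + u ^ 4))

theorem continuousOn_kernelTwoFifths : ContinuousOn kernelTwoFifths (Set.Icc 0 1) := by
  refine ContinuousOn.div (by fun_prop) (by fun_prop) fun u hu => ?_
  have := hu.1
  positivity

theorem kernelTwoFifths_nonneg {u : ℝ} (hu : 0 ≤ u) : 0 ≤ kernelTwoFifths u := by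
  unfold kernelTwoFifths
  positivity

theorem kernelTwoFifths_le {u : ℝ} (hu : 0 ≤ u) : kernelTwoFifths u ≤ 4 := by
  unfold kernelTwoFifths
  rw [div_le_iff₀ (by positivity)]
  have h2 : 0 ≤ u ^ 2 := by positivity
  have h3 : 0 ≤ u ^ 3 := by positivity
  have h4 : 0 ≤ u ^ 4 := by positivity
  have h5 : 0 ≤ u ^ 5 := by positivity
  nlinarith

theorem kernelTwoFifths_mul_one_sub_pow {u : ℝ} (hu : 0 ≤ u) (j m : ℕ) :
    kernelTwoFifths u * u ^ j * (1 - u ^ (10 * m)) =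
      ∑ k ∈ Finset.range (2 * m), 5 * u ^ (j + 5 * k) -
        ∑ k ∈ Finset.range (5 * m), 2 * u ^ (j + 2 * k) := by
  have e5 : ∑ k ∈ Finset.range (2 * m), 5 * u ^ (j + 5 * k) =
      5 * u ^ j * ∑ k ∈ Finset.range (2 * m), (u ^ 5) ^ k := by
    rw [Finset.mul_sum]
    exact Finset.sum_congr rfl fun k _ => by ring
  have e2 : ∑ k ∈ Finset.range (5 * m), 2 * u ^ (j + 2 * k) =
      2 * u ^ j * ∑ k ∈ Finset.range (5 * m), (u ^ 2) ^ k := by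
    rw [Finset.mul_sum]
    exact Finset.sum_congr rfl fun k _ => by ring
  rw [e5, e2]
  rcases eq_or_ne u 1 with rfl | h1
  · simp
    ring
  have g5 := mul_neg_geom_sum (u ^ 5) (2 * m)
  have g2 := mul_neg_geom_sum (u ^ 2) (5 * m)
  have p5 : (u ^ 5) ^ (2 * m) = u ^ (10 * m) := by rw [← pow_mul]; congr 1; ring
  have p2 : (u ^ 2) ^ (5 * m) = u ^ (10 * m) := by rw [← pow_mul]; congr 1; ring
  rw [p5] at g5
  rw [p2] at g2
  have h1' : 1 - u ≠ 0 := sub_ne_zero.2 h1.symm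
  have hP : 1 + u + u ^ 2 + u ^ 3 + u ^ 4 ≠ 0 := by positivity
  have hu1 : 1 + u ≠ 0 := by positivity
  have n5 : 1 - u ^ 5 ≠ 0 := by
    rw [show 1 - u ^ 5 = (1 - u) * (1 + u + u ^ 2 + u ^ 3 + u ^ 4) by ring]
    exact mul_ne_zero h1' hP
  have n2 : 1 - u ^ 2 ≠ 0 := by
    rw [show 1 - u ^ 2 = (1 - u) * (1 + u) by ring]
    exact mul_ne_zero h1' hu1
  rw [mul_comm, ← eq_div_iff n5] at g5
  rw [mul_comm, ← eq_div_iff n2] at g2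
  have hK : kernelTwoFifths u = 5 / (1 - u ^ 5) - 2 / (1 - u ^ 2) := by
    unfold kernelTwoFifths
    rw [div_sub_div _ _ n5 n2, div_eq_div_iff (mul_ne_zero hu1 hP) (mul_ne_zero n5 n2)]
    ring
  rw [g5, g2, hK]
  ring

theorem integral_kernelTwoFifths_mul_one_sub_pow (n m : ℕ) :
    ∫ u in (0 : ℝ)..1, kernelTwoFifths u * u ^ (2 * n + 1) * (1 - u ^ (10 * m)) =
      (digamma (((n : ℝ) + 1) * (2 / 5) + (2 * m : ℕ)) - digamma (((n : ℝ) + 1) * (2 / 5))) -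
        (digamma (((n : ℝ) + 1) * 1 + (5 * m : ℕ)) - digamma (((n : ℝ) + 1) * 1)) := by
  rw [digamma_add_nat (by positivity), digamma_add_nat (by positivity)]
  have : ∫ u in (0 : ℝ)..1, kernelTwoFifths u * u ^ (2 * n + 1) * (1 - u ^ (10 * m)) =
      ∫ u in (0 : ℝ)..1, (∑ k ∈ Finset.range (2 * m), 5 * u ^ (2 * n + 1 + 5 * k) -
        ∑ k ∈ Finset.range (5 * m), 2 * u ^ (2 * n + 1 + 2 * k)) := by
    refine intervalIntegral.integral_congr fun u hu => ?_
    rw [Set.uIcc_of_le zero_le_one] at hu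
    exact kernelTwoFifths_mul_one_sub_pow hu.1 _ _
  rw [this, intervalIntegral.integral_sub, intervalIntegral.integral_finsetSum,
    intervalIntegral.integral_finsetSum]
  · simp only [intervalIntegral.integral_const_mul, integral_pow, add_sub_cancel_left]
    congr 1 <;> refine Finset.sum_congr rfl fun k _ => ?_
    · push_cast
      simp
      field_simp
      ring
    · push_cast
      simp
      field_simp
      ring
  all_goals intros; apply Continuous.intervalIntegrable; fun_prop

theorem intervalIntegrable_kernelTwoFifths_mul {f : ℝ → ℝ} (hf : Continuous f) :
    IntervalIntegrable (fun u => kernelTwoFifths u * f u) MeasureTheory.volume 0 1 := by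
  apply ContinuousOn.intervalIntegrable
  rw [Set.uIcc_of_le zero_le_one]
  exact continuousOn_kernelTwoFifths.mul hf.continuousOn

theorem integral_kernelTwoFifths_mul_pow_nonneg (j : ℕ) :
    0 ≤ ∫ u in (0 : ℝ)..1, kernelTwoFifths u * u ^ j :=
  intervalIntegral.integral_nonneg zero_le_one fun _ hu =>
    mul_nonneg (kernelTwoFifths_nonneg hu.1) (pow_nonneg hu.1 _)

theorem integral_kernelTwoFifths_mul_pow_le (j : ℕ) :
    ∫ u in (0 : ℝ)..1, kernelTwoFifths u * u ^ j ≤ 4 / ((j : ℝ) + 1) := by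
  calc _ ≤ ∫ u in (0 : ℝ)..1, 4 * u ^ j := by
        refine intervalIntegral.integral_mono_on zero_le_one
          (intervalIntegrable_kernelTwoFifths_mul (by fun_prop))
          (Continuous.intervalIntegrable (by fun_prop) _ _) fun u hu => ?_
        exact mul_le_mul_of_nonneg_right (kernelTwoFifths_le hu.1) (pow_nonneg hu.1 _)
    _ = _ := by
        rw [intervalIntegral.integral_const_mul, integral_pow]
        simp
        ring

theorem digamma_sub_digamma_eq_integral (n : ℕ) :
    digamma (((n : ℝ) + 1) * (2 / 5)) - digamma (((n : ℝ) + 1) * 1) =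
      Real.log (2 / 5) - ∫ u in (0 : ℝ)..1, kernelTwoFifths u * u ^ (2 * n + 1) := by
  set x := ((n : ℝ) + 1) * (2 / 5) with hx
  set y := ((n : ℝ) + 1) * 1 with hy
  set I := ∫ u in (0 : ℝ)..1, kernelTwoFifths u * u ^ (2 * n + 1) with hI
  have hx0 : 0 < x := by positivity
  have hy0 : 0 < y := by positivity
  have hbound : ∀ m : ℕ, |digamma x - digamma y - (Real.log (2 / 5) - I)| ≤
      8 * (1 / ((m : ℝ) + 1)) := by
    intro m
    have hm : (0 : ℝ) < (m : ℝ) + 1 := by positivity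
    have hn : (0 : ℝ) ≤ n := n.cast_nonneg
    have h1 := integral_kernelTwoFifths_mul_one_sub_pow n m
    have h2 : ∫ u in (0 : ℝ)..1, kernelTwoFifths u * u ^ (2 * n + 1) * (1 - u ^ (10 * m)) =
        I - ∫ u in (0 : ℝ)..1, kernelTwoFifths u * u ^ (2 * n + 1 + 10 * m) := by
      rw [hI, ← intervalIntegral.integral_sub
        (intervalIntegrable_kernelTwoFifths_mul (by fun_prop))
        (intervalIntegrable_kernelTwoFifths_mul (by fun_prop))]
      congr 1 with u
      ring
    rw [h2, ← hx, ← hy] at h1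
    have h3 := integral_kernelTwoFifths_mul_pow_nonneg (2 * n + 1 + 10 * m)
    have h4 := integral_kernelTwoFifths_mul_pow_le (2 * n + 1 + 10 * m)
    have h5 := abs_le.1 (abs_digamma_sub_log_le (x := x + (2 * m : ℕ)) (by positivity))
    have h6 := abs_le.1 (abs_digamma_sub_log_le (x := y + (5 * m : ℕ)) (by positivity))
    have h7 : Real.log (x + (2 * m : ℕ)) - Real.log (y + (5 * m : ℕ)) = Real.log (2 / 5) := by
      rw [← Real.log_div (by positivity) (by positivity)]
      congr 1
      rw [div_eq_div_iff (by positivity) (by positivity), hx, hy]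
      push_cast
      ring
    have h8 : 1 / (x + (2 * m : ℕ)) ≤ 5 / 2 * (1 / ((m : ℝ) + 1)) := by
      rw [div_mul_div_comm, div_le_div_iff₀ (by positivity) (by positivity), hx]
      push_cast
      nlinarith
    have h9 : 1 / (y + (5 * m : ℕ)) ≤ 1 * (1 / ((m : ℝ) + 1)) := by
      rw [one_mul, div_le_div_iff₀ (by positivity) (by positivity), hy]
      push_cast
      nlinarith
    have h10 : 4 / (((2 * n + 1 + 10 * m : ℕ) : ℝ) + 1) ≤ 4 * (1 / ((m : ℝ) + 1)) := by
      rw [mul_one_div]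
      refine div_le_div_of_nonneg_left (by norm_num) hm ?_
      push_cast
      nlinarith
    have h11 : 0 < 1 / ((m : ℝ) + 1) := by positivity
    rw [abs_le]
    constructor <;> linarith
  have hlim := (tendsto_one_div_add_atTop_nhds_zero_nat (𝕜 := ℝ)).const_mul 8
  rw [mul_zero] at hlim
  have h0 := abs_nonpos_iff.1 (ge_of_tendsto' hlim hbound)
  linarith

/-- `log (1 - u ^ 2)` split into the contributions of its two zeros. -/
noncomputable def logOneSubSq (u : ℝ) : ℝ := Real.log (1 - u) + Real.log (1 + u)

theorem logOneSubSq_eq {u : ℝ} (h0 : 0 < u) (h1 : u < 1) :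
    logOneSubSq u = Real.log (1 - u ^ 2) := by
  rw [logOneSubSq, ← Real.log_mul (by linarith) (by linarith)]
  congr 1
  ring

theorem integral_congr_Ioo_zero_one {f g : ℝ → ℝ} (h : ∀ u ∈ Set.Ioo (0 : ℝ) 1, f u = g u) :
    ∫ u in (0 : ℝ)..1, f u = ∫ u in (0 : ℝ)..1, g u := by
  rw [intervalIntegral.integral_of_le zero_le_one, intervalIntegral.integral_of_le zero_le_one,
    MeasureTheory.integral_Ioc_eq_integral_Ioo, MeasureTheory.integral_Ioc_eq_integral_Ioo]
  exact MeasureTheory.setIntegral_congr_fun measurableSet_Ioo h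

theorem hasSum_kernelTwoFifths_mul_pow :
    HasSum (fun n : ℕ => (∫ u in (0 : ℝ)..1, kernelTwoFifths u * u ^ (2 * n + 1)) / ((n : ℝ) + 1))
      (∫ u in (0 : ℝ)..1, -(kernelTwoFifths u * logOneSubSq u / u)) := by
  have hF : ∀ n : ℕ, IntervalIntegrable
      (fun u => kernelTwoFifths u * (u ^ (2 * n + 1) / ((n : ℝ) + 1)))
      MeasureTheory.volume 0 1 :=
    fun n => intervalIntegrable_kernelTwoFifths_mul (by fun_prop)
  have hI : ∀ n : ℕ, ∫ u in (0 : ℝ)..1, kernelTwoFifths u * (u ^ (2 * n + 1) / ((n : ℝ) + 1)) =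
      (∫ u in (0 : ℝ)..1, kernelTwoFifths u * u ^ (2 * n + 1)) / ((n : ℝ) + 1) := by
    intro n
    rw [← intervalIntegral.integral_div]
    congr 1 with u
    ring
  have h := MeasureTheory.hasSum_integral_of_summable_integral_norm
    (μ := MeasureTheory.volume.restrict (Set.Ioc (0 : ℝ) 1))
    (F := fun (n : ℕ) u => kernelTwoFifths u * (u ^ (2 * n + 1) / ((n : ℝ) + 1)))
    (fun n => (intervalIntegrable_iff_integrableOn_Ioc_of_le zero_le_one).1 (hF n)) ?_
  · simp only [← intervalIntegral.integral_of_le (zero_le_one' ℝ), hI] at h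
    refine (integral_congr_Ioo_zero_one fun u hu => ?_) ▸ h
    have h0 := hu.1
    have hs := ((Real.hasSum_pow_div_log_of_abs_lt_one (x := u ^ 2)
      (by rw [abs_of_nonneg (sq_nonneg u)]; nlinarith [hu.2])).mul_left (kernelTwoFifths u / u))
    have e : ∀ n : ℕ, kernelTwoFifths u / u * ((u ^ 2) ^ (n + 1) / ((n : ℝ) + 1)) =
        kernelTwoFifths u * (u ^ (2 * n + 1) / ((n : ℝ) + 1)) := by
      intro n
      rw [← pow_mul, show 2 * (n + 1) = 2 * n + 1 + 1 by ring, pow_succ u (2 * n + 1)]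
      field_simp
    simp only [e] at hs
    rw [hs.tsum_eq, logOneSubSq_eq hu.1 hu.2]
    ring
  · simp only [← intervalIntegral.integral_of_le (zero_le_one' ℝ)]
    refine Summable.of_norm_bounded (summable_one_div_succ_sq.mul_left 2) fun n => ?_
    have e : ∫ u in (0 : ℝ)..1, ‖kernelTwoFifths u * (u ^ (2 * n + 1) / ((n : ℝ) + 1))‖ =
        (∫ u in (0 : ℝ)..1, kernelTwoFifths u * u ^ (2 * n + 1)) / ((n : ℝ) + 1) := by
      rw [← hI]
      refine intervalIntegral.integral_congr fun u hu => ?_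
      rw [Set.uIcc_of_le zero_le_one] at hu
      exact Real.norm_of_nonneg (mul_nonneg (kernelTwoFifths_nonneg hu.1)
        (div_nonneg (pow_nonneg hu.1 _) (by positivity)))
    rw [e, Real.norm_of_nonneg (div_nonneg (integral_kernelTwoFifths_mul_pow_nonneg _)
      (by positivity)), div_le_iff₀ (by positivity)]
    refine (integral_kernelTwoFifths_mul_pow_le _).trans_eq ?_
    push_cast
    field_simp
    ring

theorem herglotzF_two_fifths_sub_one_eq_integral :
    herglotzF (2 / 5) - herglotzF 1 =
      ∫ u in (0 : ℝ)..1, kernelTwoFifths u * logOneSubSq u / u := by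
  unfold herglotzF
  rw [← (summable_herglotzF (by norm_num : (0 : ℝ) < 2 / 5)).tsum_sub
    (summable_herglotzF one_pos)]
  have h := hasSum_kernelTwoFifths_mul_pow.neg
  rw [intervalIntegral.integral_neg, neg_neg] at h
  rw [← h.tsum_eq]
  refine tsum_congr fun n => ?_
  have h1 := digamma_sub_digamma_eq_integral n
  have h2 : Real.log (((n : ℝ) + 1) * (2 / 5)) = Real.log (((n : ℝ) + 1) * 1) +
      Real.log (2 / 5) := by
    rw [mul_one, Real.log_mul (by positivity) (by norm_num)]
  rw [h2, ← sub_div, ← neg_div]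
  congr 1
  linarith

theorem intervalIntegrable_logOneSubSq :
    IntervalIntegrable logOneSubSq MeasureTheory.volume 0 1 := by
  have h1 := (intervalIntegral.intervalIntegrable_log' (a := 1) (b := 0)).comp_sub_left 1
  have h2 := (intervalIntegral.intervalIntegrable_log' (a := 1) (b := 2)).comp_add_left 1
  norm_num at h1 h2
  exact h1.add h2

theorem one_sub_mul_add_sq_pos {c u : ℝ} (hc : c < 1) (hu : 0 ≤ u) :
    0 < 1 - 2 * c * u + u ^ 2 := by
  nlinarith [sq_nonneg (1 - u), mul_nonneg hu (by linarith : 0 ≤ 1 - c)]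

theorem le_one_sub_mul_add_sq {c b u : ℝ} (hcb : c ≤ b) (hb : b < 1) (hu : 0 ≤ u) :
    min 1 (1 - b) ≤ 1 - 2 * c * u + u ^ 2 := by
  rcases le_total c 0 with h | h
  · refine (min_le_left _ _).trans ?_
    nlinarith [sq_nonneg u]
  · refine (min_le_right _ _).trans ?_
    have h1 : 0 ≤ 1 - c := by linarith
    nlinarith [mul_nonneg h (sq_nonneg (1 - u)), mul_nonneg h1 (sq_nonneg u)]

/-- The integral over `[0, 1]` of `log (1 - u ^ 2)` against the logarithmic derivative of
`1 - 2 c u + u ^ 2`. -/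
noncomputable def logIntegral (c : ℝ) : ℝ :=
  ∫ u in (0 : ℝ)..1, (2 * u - 2 * c) / (1 - 2 * c * u + u ^ 2) * logOneSubSq u

theorem intervalIntegrable_logIntegral {c : ℝ} (hc : c < 1) :
    IntervalIntegrable (fun u => (2 * u - 2 * c) / (1 - 2 * c * u + u ^ 2) * logOneSubSq u)
      MeasureTheory.volume 0 1 := by
  refine intervalIntegrable_logOneSubSq.continuousOn_mul ?_
  rw [Set.uIcc_of_le zero_le_one]
  exact ContinuousOn.div (by fun_prop) (by fun_prop)
    fun u hu => (one_sub_mul_add_sq_pos hc hu.1).ne'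

theorem hasDerivAt_logIntegral {c : ℝ} (hc : c < 1) :
    IntervalIntegrable
        (fun u => 2 * (u ^ 2 - 1) / (1 - 2 * c * u + u ^ 2) ^ 2 * logOneSubSq u)
        MeasureTheory.volume 0 1 ∧
      HasDerivAt logIntegral
        (∫ u in (0 : ℝ)..1, 2 * (u ^ 2 - 1) / (1 - 2 * c * u + u ^ 2) ^ 2 * logOneSubSq u) c := by
  set b := (1 + c) / 2 with hb
  have hb1 : b < 1 := by linarith
  have hδ : 0 < min 1 (1 - b) := lt_min one_pos (by linarith)
  have hI : ∀ c' < 1, IntervalIntegrable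
      (fun u => 2 * (u ^ 2 - 1) / (1 - 2 * c' * u + u ^ 2) ^ 2 * logOneSubSq u)
        MeasureTheory.volume 0 1 := by
    intro c' hc'
    refine intervalIntegrable_logOneSubSq.continuousOn_mul ?_
    rw [Set.uIcc_of_le zero_le_one]
    exact ContinuousOn.div (by fun_prop) (by fun_prop)
      fun u hu => (pow_pos (one_sub_mul_add_sq_pos hc' hu.1) 2).ne'
  have hm : ∀ f : ℝ → ℝ, IntervalIntegrable f MeasureTheory.volume 0 1 →
      MeasureTheory.AEStronglyMeasurable f (MeasureTheory.volume.restrict (Set.uIoc 0 1)) := by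
    intro f hf
    rw [Set.uIoc_of_le zero_le_one]
    exact hf.aestronglyMeasurable
  refine intervalIntegral.hasDerivAt_integral_of_dominated_loc_of_deriv_le
    (F := fun c u => (2 * u - 2 * c) / (1 - 2 * c * u + u ^ 2) * logOneSubSq u)
    (F' := fun c u => 2 * (u ^ 2 - 1) / (1 - 2 * c * u + u ^ 2) ^ 2 * logOneSubSq u)
    (bound := fun u => 2 / (min 1 (1 - b)) ^ 2 * |logOneSubSq u|)
    (Iio_mem_nhds (by linarith : c < b)) ?_ (intervalIntegrable_logIntegral hc)
    (hm _ (hI c hc)) ?_ ?_ ?_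
  · filter_upwards [Iio_mem_nhds hc] with c' hc'
    exact hm _ (intervalIntegrable_logIntegral hc')
  · refine Filter.Eventually.of_forall fun u hu x hx => ?_
    rw [Set.uIoc_of_le zero_le_one] at hu
    have h1 := le_one_sub_mul_add_sq (le_of_lt hx) hb1 hu.1.le
    have h2 : 0 < 1 - 2 * x * u + u ^ 2 := hδ.trans_le h1
    rw [norm_mul, norm_div, Real.norm_eq_abs, Real.norm_eq_abs, Real.norm_eq_abs,
      abs_of_pos (pow_pos h2 2)]
    have h3 : |2 * (u ^ 2 - 1)| ≤ 2 := by
      rw [abs_le]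
      constructor <;> nlinarith [hu.1, hu.2]
    gcongr
  · exact intervalIntegrable_logOneSubSq.abs.const_mul _
  · refine Filter.Eventually.of_forall fun u hu x hx => ?_
    rw [Set.uIoc_of_le zero_le_one] at hu
    have h2 := one_sub_mul_add_sq_pos (lt_trans hx hb1) hu.1.le
    have d1 : HasDerivAt (fun x => 2 * u - 2 * x) (-2) x := by
      simpa using ((hasDerivAt_id x).const_mul 2).const_sub (2 * u)
    have d2 : HasDerivAt (fun x => 1 - 2 * x * u + u ^ 2) (-(2 * u)) x := by
      simpa using ((((hasDerivAt_id x).const_mul 2).mul_const u).const_sub 1).add_const (u ^ 2)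
    refine ((d1.div d2 h2.ne').mul_const (logOneSubSq u)).congr_deriv ?_
    congr 2
    ring

theorem arctan_cot_half_sub {θ : ℝ} (h0 : 0 < θ) (h1 : θ < Real.pi) :
    Real.arctan ((1 - Real.cos θ) / Real.sin θ) - Real.arctan ((0 - Real.cos θ) / Real.sin θ) =
      (Real.pi - θ) / 2 := by
  have hs := Real.sin_pos_of_pos_of_lt_pi h0 h1
  have hc2 : 0 < Real.cos (θ / 2) := Real.cos_pos_of_mem_Ioo ⟨by linarith, by linarith⟩
  have hs2 : 0 < Real.sin (θ / 2) := Real.sin_pos_of_pos_of_lt_pi (by linarith) (by linarith)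
  have e1 : (1 - Real.cos θ) / Real.sin θ = Real.tan (θ / 2) := by
    have h : θ = 2 * (θ / 2) := by ring
    rw [Real.tan_eq_sin_div_cos, div_eq_div_iff hs.ne' hc2.ne', h, Real.cos_two_mul,
      Real.sin_two_mul, ← h]
    linear_combination (-2 * Real.cos (θ / 2)) * Real.sin_sq_add_cos_sq (θ / 2)
  have e2 : (0 - Real.cos θ) / Real.sin θ = Real.tan (θ - Real.pi / 2) := by
    rw [Real.tan_eq_sin_div_cos, Real.sin_sub_pi_div_two, Real.cos_sub_pi_div_two, zero_sub]
  rw [e1, e2, Real.arctan_tan (by linarith) (by linarith),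
    Real.arctan_tan (by linarith) (by linarith)]
  ring

theorem integral_deriv_logIntegral_cos {θ : ℝ} (h0 : 0 < θ) (h1 : θ < Real.pi) :
    ∫ u in (0 : ℝ)..1,
        2 * (u ^ 2 - 1) / (1 - 2 * Real.cos θ * u + u ^ 2) ^ 2 * logOneSubSq u =
      (-Real.cos θ * Real.log (2 - 2 * Real.cos θ) + Real.sin θ * (Real.pi - θ) -
        2 * Real.log 2) / Real.sin θ ^ 2 := by
  have hs := Real.sin_pos_of_pos_of_lt_pi h0 h1
  have harc := arctan_cot_half_sub h0 h1
  have hcs := Real.sin_sq_add_cos_sq θ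
  have hc : Real.cos θ < 1 := by
    have := Real.cos_lt_cos_of_nonneg_of_le_pi le_rfl h1.le h0
    rwa [Real.cos_zero] at this
  set c := Real.cos θ
  set s := Real.sin θ
  have hc1 : 1 - c ≠ 0 := by linarith
  have hP : ∀ u ∈ Set.Icc (0 : ℝ) 1, 1 - 2 * c * u + u ^ 2 ≠ 0 :=
    fun u hu => (one_sub_mul_add_sq_pos hc hu.1).ne'
  rw [intervalIntegral.integral_eq_sub_of_hasDerivAt_of_le zero_le_one
    (f := fun u => (1 - u) ^ 2 / (1 - 2 * c * u + u ^ 2) / (1 - c) * logOneSubSq u +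
      (-c * Real.log (1 - 2 * c * u + u ^ 2) + 2 * s * Real.arctan ((u - c) / s) -
        2 * Real.log (1 + u)) / s ^ 2) ?_ ?_ (hasDerivAt_logIntegral hc).1]
  · have e : 1 - 2 * c * 1 + 1 ^ 2 = 2 - 2 * c := by ring
    simp only [e, logOneSubSq]
    norm_num
    have hh : Real.arctan ((1 - c) / s) = (Real.pi - θ) / 2 + Real.arctan ((0 - c) / s) := by
      linarith
    rw [hh, zero_sub]
    field_simp
    ring
  · have e : ∀ u, (1 - u) ^ 2 / (1 - 2 * c * u + u ^ 2) / (1 - c) * logOneSubSq u =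
        (1 - u) / (1 - 2 * c * u + u ^ 2) / (1 - c) *
          ((1 - u) * Real.log (1 - u) + (1 - u) * Real.log (1 + u)) := by
      intro u
      rw [logOneSubSq]
      ring
    simp only [e]
    have l1 : ContinuousOn (fun u : ℝ => Real.log (1 + u)) (Set.Icc 0 1) :=
      ContinuousOn.log (by fun_prop) fun u hu => by linarith [hu.1]
    have l2 : ContinuousOn (fun u : ℝ => Real.log (1 - 2 * c * u + u ^ 2)) (Set.Icc 0 1) :=
      ContinuousOn.log (by fun_prop) hP
    have l3 : ContinuousOn (fun u : ℝ => (1 - u) * Real.log (1 - u)) (Set.Icc 0 1) :=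
      (Real.continuous_mul_log.comp (continuous_const.sub continuous_id)).continuousOn
    have l4 : ContinuousOn (fun u : ℝ => (1 - u) / (1 - 2 * c * u + u ^ 2)) (Set.Icc 0 1) :=
      ContinuousOn.div (by fun_prop) (by fun_prop) hP
    have l5 : ContinuousOn (fun u : ℝ => Real.arctan ((u - c) / s)) (Set.Icc 0 1) :=
      (Real.continuous_arctan.comp (by fun_prop)).continuousOn
    fun_prop
  · intro u hu
    have hPu := hP u (Set.Ioo_subset_Icc_self hu)
    have hu1 : 1 - u ≠ 0 := by linarith [hu.2]
    have hu2 : 1 + u ≠ 0 := by linarith [hu.1]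
    have dP : HasDerivAt (fun u => 1 - 2 * c * u + u ^ 2) (2 * u - 2 * c) u := by
      refine ((((hasDerivAt_id u).const_mul (2 * c)).const_sub 1).add
        (hasDerivAt_pow 2 u)).congr_deriv ?_
      norm_num
      ring
    have dm : HasDerivAt (fun u : ℝ => 1 - u) (-1) u := (hasDerivAt_id u).const_sub 1
    have dp : HasDerivAt (fun u : ℝ => 1 + u) 1 u := (hasDerivAt_id u).const_add 1
    have da : HasDerivAt (fun u : ℝ => (u - c) / s) (1 / s) u :=
      ((hasDerivAt_id u).sub_const c).div_const s
    have d1 := (((dm.pow 2).div dP hPu).div_const (1 - c)).mul ((dm.log hu1).add (dp.log hu2))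
    have d2 := ((((dP.log hPu).const_mul (-c)).add (da.arctan.const_mul (2 * s))).sub
      ((dp.log hu2).const_mul 2)).div_const (s ^ 2)
    refine (d1.add d2).congr_deriv ?_
    have ea : 1 + ((u - c) / s) ^ 2 = (1 - 2 * c * u + u ^ 2) / s ^ 2 := by
      field_simp
      linear_combination hcs
    rw [ea]
    have hs2 : s ^ 2 = (1 - c) * (1 + c) := by linear_combination hcs
    have hc2 : 1 + c ≠ 0 := by
      intro h
      rw [h, mul_zero] at hs2
      exact hs.ne' (pow_eq_zero_iff two_ne_zero |>.1 hs2)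
    have es : 2 * s * (1 / ((1 - 2 * c * u + u ^ 2) / s ^ 2) * (1 / s)) =
        2 * ((1 - c) * (1 + c)) / (1 - 2 * c * u + u ^ 2) := by
      rw [← hs2]
      field_simp
    rw [es, hs2, logOneSubSq]
    simp only [Pi.add_apply, Pi.pow_apply, Pi.div_apply]
    obtain ⟨Q, hQ⟩ : ∃ Q, Q = 1 - 2 * c * u + u ^ 2 := ⟨_, rfl⟩
    rw [← hQ] at hPu ⊢
    field_simp
    rw [hQ]
    ring

theorem Li2_one_half : Li2 (1 / 2) = Real.pi ^ 2 / 12 - Real.log 2 ^ 2 / 2 := by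
  have h := Li2_add_Li2_one_sub (x := 1 / 2) (by norm_num) (by norm_num)
  have e : (1 : ℝ) - 1 / 2 = 1 / 2 := by norm_num
  have e2 : Real.log (1 / 2) = -Real.log 2 := by rw [one_div, Real.log_inv]
  rw [e, e2] at h
  linarith

theorem integral_logOneSubSq_div_one_add :
    ∫ u in (0 : ℝ)..1, logOneSubSq u / (1 + u) = Real.log 2 ^ 2 - Real.pi ^ 2 / 12 := by
  have hint : IntervalIntegrable (fun u => logOneSubSq u / (1 + u)) MeasureTheory.volume 0 1 := by
    simp only [div_eq_mul_inv]
    refine intervalIntegrable_logOneSubSq.mul_continuousOn ?_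
    rw [Set.uIcc_of_le zero_le_one]
    exact ContinuousOn.inv₀ (by fun_prop) fun u hu => by linarith [hu.1]
  rw [intervalIntegral.integral_eq_sub_of_hasDerivAt_of_le zero_le_one
    (f := fun u => -Li2 ((1 + u) / 2) + Real.log 2 * Real.log (1 + u) +
      Real.log (1 + u) ^ 2 / 2) ?_ ?_ hint]
  · norm_num
    rw [Li2_one, Li2_one_half]
    ring
  · have l1 : ContinuousOn (fun u : ℝ => Real.log (1 + u)) (Set.Icc 0 1) :=
      ContinuousOn.log (by fun_prop) fun u hu => by linarith [hu.1]
    have l2 : ContinuousOn (fun u : ℝ => Li2 ((1 + u) / 2)) (Set.Icc 0 1) :=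
      continuousOn_Li2.comp (by fun_prop) fun u hu => by
        constructor <;> linarith [hu.1, hu.2]
    fun_prop
  · intro u hu
    have hu0 := hu.1
    have hu1 : 0 < 1 - u := by linarith [hu.2]
    have dp : HasDerivAt (fun u : ℝ => 1 + u) 1 u := (hasDerivAt_id u).const_add 1
    have dl := dp.log (by linarith)
    have d1 := (hasDerivAt_Li2 (x := (1 + u) / 2) (by linarith) (by linarith)).comp u
      (dp.div_const 2)
    refine ((d1.neg.add (dl.const_mul (Real.log 2))).add ((dl.pow 2).div_const 2)).congr_deriv ?_
    rw [show 1 - (1 + u) / 2 = (1 - u) / 2 by ring, Real.log_div hu1.ne' two_ne_zero, logOneSubSq]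
    field_simp
    norm_num
    ring

theorem logIntegral_neg_one : logIntegral (-1) = 2 * Real.log 2 ^ 2 - Real.pi ^ 2 / 6 := by
  have h : logIntegral (-1) = ∫ u in (0 : ℝ)..1, 2 * (logOneSubSq u / (1 + u)) := by
    refine integral_congr_Ioo_zero_one fun u hu => ?_
    have h1 : 1 + u ≠ 0 := by linarith [hu.1]
    rw [show 1 - 2 * -1 * u + u ^ 2 = (1 + u) ^ 2 by ring]
    field_simp
    ring
  rw [h, intervalIntegral.integral_const_mul, integral_logOneSubSq_div_one_add]
  ring

theorem integral_logOneSubSq_div :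
    IntervalIntegrable (fun u => logOneSubSq u / u) MeasureTheory.volume 0 1 ∧
      ∫ u in (0 : ℝ)..1, logOneSubSq u / u = -(Real.pi ^ 2 / 12) := by
  have hc : ContinuousOn (fun u : ℝ => Li2 (u ^ 2) / 2) (Set.Icc 0 1) := by
    have : ContinuousOn (fun u : ℝ => Li2 (u ^ 2)) (Set.Icc 0 1) :=
      continuousOn_Li2.comp (by fun_prop) fun u hu =>
        ⟨sq_nonneg u, pow_le_one₀ hu.1 hu.2⟩
    fun_prop
  have hd : ∀ u ∈ Set.Ioo (0 : ℝ) 1,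
      HasDerivAt (fun u : ℝ => Li2 (u ^ 2) / 2) (-(logOneSubSq u / u)) u := by
    intro u hu
    have hu0 := hu.1
    refine (((hasDerivAt_Li2 (x := u ^ 2) (by positivity) (by nlinarith [hu.2])).comp u
      (hasDerivAt_pow 2 u)).div_const 2).congr_deriv ?_
    rw [logOneSubSq_eq hu.1 hu.2]
    norm_num
    field_simp
  have hint : IntervalIntegrable (fun u => -(logOneSubSq u / u)) MeasureTheory.volume 0 1 := by
    refine intervalIntegral.intervalIntegrable_deriv_of_nonneg
      (by rwa [Set.uIcc_of_le zero_le_one]) (by simpa using hd) ?_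
    intro u hu
    simp only [zero_le_one, inf_of_le_left, sup_of_le_right] at hu
    have : logOneSubSq u ≤ 0 := by
      rw [logOneSubSq_eq hu.1 hu.2]
      exact Real.log_nonpos (by nlinarith [hu.1, hu.2]) (by nlinarith [hu.1])
    rw [← neg_div]
    exact div_nonneg (by linarith) hu.1.le
  have hint' : IntervalIntegrable (fun u => logOneSubSq u / u) MeasureTheory.volume 0 1 := by
    simpa only [Pi.neg_def, neg_neg] using hint.neg
  refine ⟨hint', ?_⟩
  have h := intervalIntegral.integral_eq_sub_of_hasDerivAt_of_le zero_le_one hc hd hint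
  rw [intervalIntegral.integral_neg] at h
  norm_num [Li2_zero, Li2_one] at h
  linarith

theorem logIntegral_cos {θ : ℝ} (h0 : 0 < θ) (h1 : θ < Real.pi) :
    logIntegral (Real.cos θ) = (Real.pi - θ) ^ 2 / 2 - Li2 (Real.cos (θ / 2) ^ 2) / 2 +
      Real.log (2 * Real.sin (θ / 2)) ^ 2 + 2 * Real.log 2 * Real.log (2 * Real.sin (θ / 2)) -
      Real.log 2 ^ 2 - Real.pi ^ 2 / 6 := by
  have hsin : ∀ x ∈ Set.Icc θ Real.pi, 0 < Real.sin (x / 2) := fun x hx =>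
    Real.sin_pos_of_pos_of_lt_pi (by linarith [hx.1]) (by linarith [hx.2, Real.pi_pos])
  have hcos : ∀ x ∈ Set.Icc θ Real.pi, Real.cos x < 1 := fun x hx => by
    have := Real.cos_lt_cos_of_nonneg_of_le_pi le_rfl hx.2 (h0.trans_le hx.1)
    rwa [Real.cos_zero] at this
  have h := eq_of_hasDerivAt_zero_Ioo
    (f := fun x => logIntegral (Real.cos x) - ((Real.pi - x) ^ 2 / 2 -
      Li2 (Real.cos (x / 2) ^ 2) / 2 + Real.log (2 * Real.sin (x / 2)) ^ 2 +
      2 * Real.log 2 * Real.log (2 * Real.sin (x / 2)))) h1.le ?_ ?_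
  · simp only [Real.cos_pi, Real.cos_pi_div_two, Real.sin_pi_div_two, logIntegral_neg_one] at h
    norm_num [Li2_zero] at h
    linarith
  · have l1 : ContinuousOn (fun x : ℝ => logIntegral (Real.cos x)) (Set.Icc θ Real.pi) :=
      fun x hx => (ContinuousAt.comp (f := Real.cos)
        (hasDerivAt_logIntegral (hcos x hx)).2.continuousAt
        Real.continuous_cos.continuousAt).continuousWithinAt
    have l2 : ContinuousOn (fun x : ℝ => Li2 (Real.cos (x / 2) ^ 2)) (Set.Icc θ Real.pi) :=
      continuousOn_Li2.comp (by fun_prop) fun x _ => ⟨sq_nonneg _, Real.cos_sq_le_one _⟩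
    have l3 : ContinuousOn (fun x : ℝ => Real.log (2 * Real.sin (x / 2))) (Set.Icc θ Real.pi) :=
      ContinuousOn.log (by fun_prop) fun x hx => (mul_pos two_pos (hsin x hx)).ne'
    fun_prop
  · intro x hx
    have hx' := Set.Ioo_subset_Icc_self hx
    have hs := hsin x hx'
    have hc : 0 < Real.cos (x / 2) :=
      Real.cos_pos_of_mem_Ioo ⟨by linarith [hx.1, Real.pi_pos], by linarith [hx.2]⟩
    have hcs := Real.sin_sq_add_cos_sq (x / 2)
    have d0 : HasDerivAt (fun x : ℝ => x / 2) (1 / 2) x := (hasDerivAt_id x).div_const 2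
    have d1 := (hasDerivAt_logIntegral (hcos x hx')).2.comp x (Real.hasDerivAt_cos x)
    have d2 := (((hasDerivAt_id x).const_sub Real.pi).pow 2).div_const 2
    have d3 := ((hasDerivAt_Li2 (x := Real.cos (x / 2) ^ 2) (by positivity)
      (by nlinarith)).comp x (d0.cos.pow 2)).div_const 2
    have d4 := (d0.sin.const_mul 2).log (mul_pos two_pos hs).ne'
    refine (d1.sub (((d2.sub d3).add (d4.pow 2)).add
      (d4.const_mul (2 * Real.log 2)))).congr_deriv ?_
    rw [integral_deriv_logIntegral_cos (h0.trans hx.1) hx.2]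
    have e1 : Real.cos x = 1 - 2 * Real.sin (x / 2) ^ 2 := by
      have : Real.cos x = Real.cos (2 * (x / 2)) := by ring_nf
      rw [this, Real.cos_two_mul]
      linarith
    have e2 : Real.sin x = 2 * Real.sin (x / 2) * Real.cos (x / 2) := by
      have : Real.sin x = Real.sin (2 * (x / 2)) := by ring_nf
      rw [this, Real.sin_two_mul]
    have e3 : 1 - Real.cos (x / 2) ^ 2 = Real.sin (x / 2) ^ 2 := by linarith
    rw [e1, e2, e3, show 2 - 2 * (1 - 2 * Real.sin (x / 2) ^ 2) =
      (2 * Real.sin (x / 2)) ^ 2 by ring, Real.log_pow, Real.log_pow,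
      Real.log_mul two_ne_zero hs.ne']
    generalize Real.log (Real.sin (x / 2)) = L
    generalize Real.sin (x / 2) = S at *
    generalize Real.cos (x / 2) = C at *
    norm_num
    field_simp
    linear_combination (-2 * Real.log 2 - L) * hcs

/-- A specialization of the five-term relation in which two of the terms cancel. -/
theorem Li2_add_Li2_of_add_eq_of_mul_eq {a b : ℝ} (ha : 0 < a) (hb : 0 < b)
    (hadd : a + b = 3 / 4) (hmul : a * b = 1 / 16) :
    Li2 a + Li2 b = Li2 (4 / 5) + Real.log (4 / 5) * Real.log (1 / 5) -
      Real.log b * Real.log (1 - b) - (Real.log b - Real.log (1 - a)) *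
        (Real.log (1 / (4 * (1 - b))) - Real.log (1 - a)) := by
  have ha1 : 0 < 1 - a := by linarith
  have hb1 : 0 < 1 - b := by linarith
  have h5 := Li2_five_term (p := 1 - b) (q := a / (1 - b)) hb1.le (by linarith)
    (by positivity) (by rw [div_lt_one hb1]; linarith)
  have e1 : (1 - b) * (a / (1 - b)) = a := by field_simp
  have e2 : 1 - a / (1 - b) = 1 / (4 * (1 - b)) := by
    rw [eq_div_iff (by positivity), sub_mul, div_mul_eq_mul_div, div_eq_iff hb1.ne' |>.2
      (show a * (4 * (1 - b)) = 4 * a * (1 - b) by ring)]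
    linarith
  have e3 : (1 - b) * (1 / (4 * (1 - b))) / (1 - a) = a / (1 - b) := by
    rw [div_eq_div_iff ha1.ne' hb1.ne']
    field_simp
    obtain rfl : b = 3 / 4 - a := by linarith
    linarith
  have e4 : a / (1 - b) * (1 - (1 - b)) / (1 - a) = 1 / 5 := by
    rw [div_mul_eq_mul_div, div_div, div_eq_div_iff (by positivity) (by norm_num)]
    linarith
  rw [e1, e2, e3, e4, sub_sub_cancel] at h5
  have r1 := Li2_add_Li2_one_sub hb (by linarith)
  have r2 := Li2_add_Li2_one_sub (x := 4 / 5) (by norm_num) (by norm_num)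
  rw [show (1 : ℝ) - 4 / 5 = 1 / 5 by norm_num] at r2
  linarith

theorem integral_kernelTwoFifths_mul_logOneSubSq {c d : ℝ} (hc : c < 1) (hd : d < 1)
    (hadd : c + d = -1 / 2) (hmul : c * d = -1 / 4) :
    ∫ u in (0 : ℝ)..1, kernelTwoFifths u * logOneSubSq u / u =
      3 * (-(Real.pi ^ 2 / 12)) + 1 / 2 * logIntegral (-1) - logIntegral c - logIntegral d := by
  have i0 := integral_logOneSubSq_div.1.const_mul 3
  have i1 := (intervalIntegrable_logIntegral (by norm_num : (-1 : ℝ) < 1)).const_mul (1 / 2)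
  have i2 := intervalIntegrable_logIntegral hc
  have i3 := intervalIntegrable_logIntegral hd
  rw [← integral_logOneSubSq_div.2, logIntegral, logIntegral, logIntegral,
    ← intervalIntegral.integral_const_mul, ← intervalIntegral.integral_const_mul,
    ← intervalIntegral.integral_add i0 i1, ← intervalIntegral.integral_sub (i0.add i1) i2,
    ← intervalIntegral.integral_sub ((i0.add i1).sub i2) i3]
  refine integral_congr_Ioo_zero_one fun u hu => ?_
  have hu0 := hu.1
  have hP := (one_sub_mul_add_sq_pos hc hu0.le).ne'
  have hQ := (one_sub_mul_add_sq_pos hd hu0.le).ne'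
  have hPQ : 1 + u + u ^ 2 + u ^ 3 + u ^ 4 =
      (1 - 2 * c * u + u ^ 2) * (1 - 2 * d * u + u ^ 2) := by
    linear_combination (2 * u + 2 * u ^ 3) * hadd - 4 * u ^ 2 * hmul
  have hlog : (2 * u - 2 * c) / (1 - 2 * c * u + u ^ 2) + (2 * u - 2 * d) / (1 - 2 * d * u + u ^ 2)
      = (1 + 2 * u + 3 * u ^ 2 + 4 * u ^ 3) / (1 + u + u ^ 2 + u ^ 3 + u ^ 4) := by
    rw [div_add_div _ _ hP hQ, hPQ]
    congr 1
    linear_combination (-2 - 6 * u ^ 2) * hadd + 8 * u * hmul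
  have h1 : (2 * u - 2 * -1) / (1 - 2 * -1 * u + u ^ 2) = 2 / (1 + u) := by
    rw [show 1 - 2 * -1 * u + u ^ 2 = (1 + u) ^ 2 by ring]
    field_simp
    ring
  have hK : kernelTwoFifths u / u = 3 / u + 1 / (1 + u) -
      (1 + 2 * u + 3 * u ^ 2 + 4 * u ^ 3) / (1 + u + u ^ 2 + u ^ 3 + u ^ 4) := by
    unfold kernelTwoFifths
    field_simp
    ring
  rw [h1]
  linear_combination logOneSubSq u * hK + logOneSubSq u * hlog

theorem herglotzF_two_fifths :
    herglotzF (2 / 5) - herglotzF 1 =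
      Li2 (4 / 5) / 2 - Real.pi ^ 2 / 5
        + Real.log (2 * Real.sin (Real.pi / 5)) ^ 2
        + Real.log (2 * Real.sin (2 * Real.pi / 5)) ^ 2
        + Real.log 2 * Real.log (2 / 5) := by
  have hpi := Real.pi_pos
  have h5 : Real.sqrt 5 ^ 2 = 5 := Real.sq_sqrt (by norm_num)
  set a := Real.cos (Real.pi / 5) ^ 2 with ha
  set b := Real.cos (2 * Real.pi / 5) ^ 2 with hb
  have hcos2 : Real.cos (2 * Real.pi / 5) = 2 * a - 1 := by
    rw [ha, ← Real.cos_two_mul]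
    congr 1
    ring
  have hcos4 : Real.cos (4 * Real.pi / 5) = 2 * b - 1 := by
    rw [hb, ← Real.cos_two_mul]
    congr 1
    ring
  have ha' : a = (3 + Real.sqrt 5) / 8 := by
    rw [ha, Real.cos_pi_div_five]
    linear_combination h5 / 16
  have hb' : b = (3 - Real.sqrt 5) / 8 := by
    rw [hb, hcos2, ha']
    linear_combination h5 / 16
  have hadd : a + b = 3 / 4 := by rw [ha', hb']; ring
  have hmul : a * b = 1 / 16 := by
    rw [ha', hb']
    linear_combination -h5 / 64
  have ha0 : 0 < a := by
    rw [ha']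
    positivity
  have hb0 : 0 < b := pos_of_mul_pos_right (hmul ▸ by norm_num) ha0.le
  have hsa : 1 - a = Real.sin (Real.pi / 5) ^ 2 := by
    linarith [Real.sin_sq_add_cos_sq (Real.pi / 5)]
  have hsb : 1 - b = Real.sin (2 * Real.pi / 5) ^ 2 := by
    linarith [Real.sin_sq_add_cos_sq (2 * Real.pi / 5)]
  have hsa0 : 0 < Real.sin (Real.pi / 5) :=
    Real.sin_pos_of_pos_of_lt_pi (by linarith) (by linarith)
  have hsb0 : 0 < Real.sin (2 * Real.pi / 5) :=
    Real.sin_pos_of_pos_of_lt_pi (by linarith) (by linarith)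
  have ha1 : 0 < 1 - a := by linarith
  have hb1 : 0 < 1 - b := by linarith
  set A := Real.log (2 * Real.sin (Real.pi / 5)) with hA
  set B := Real.log (2 * Real.sin (2 * Real.pi / 5)) with hB
  set l := Real.log 2 with hl
  have h4 : Real.log 4 = 2 * l := by
    rw [show (4 : ℝ) = 2 ^ 2 by norm_num, Real.log_pow, hl]
    norm_num
  have l1a : Real.log (1 - a) = 2 * A - 2 * l := by
    rw [hsa, Real.log_pow, hA, Real.log_mul two_ne_zero hsa0.ne']
    push_cast
    ring
  have l1b : Real.log (1 - b) = 2 * B - 2 * l := by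
    rw [hsb, Real.log_pow, hB, Real.log_mul two_ne_zero hsb0.ne']
    push_cast
    ring
  have lb : Real.log b = 2 * A - 2 * B - 2 * l := by
    have : 1 - a = 4 * b * (1 - b) := by
      linear_combination (4 * b - 1) * hadd - 4 * hmul
    have := congrArg Real.log this
    rw [Real.log_mul (by positivity) hb1.ne', Real.log_mul (by norm_num) hb0.ne', h4, l1a,
      l1b] at this
    linarith
  have l5 : Real.log 5 = 2 * A + 2 * B := by
    have : 5 = 4 * 4 * ((1 - a) * (1 - b)) := by linarith
    have := congrArg Real.log this
    rw [Real.log_mul (by norm_num) (by positivity), Real.log_mul ha1.ne' hb1.ne',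
      Real.log_mul (by norm_num) (by norm_num), h4, l1a, l1b] at this
    linarith
  have lq : Real.log (1 / (4 * (1 - b))) = -(2 * B) := by
    rw [one_div, Real.log_inv, Real.log_mul (by norm_num) hb1.ne', h4, l1b]
    ring
  have hLi := Li2_add_Li2_of_add_eq_of_mul_eq ha0 hb0 hadd hmul
  rw [lq, lb, l1a, l1b, Real.log_div (by norm_num) (by norm_num), h4, one_div, Real.log_inv,
    l5] at hLi
  have t2 := logIntegral_cos (θ := 2 * Real.pi / 5) (by linarith) (by linarith)
  have t4 := logIntegral_cos (θ := 4 * Real.pi / 5) (by linarith) (by linarith)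
  rw [show 2 * Real.pi / 5 / 2 = Real.pi / 5 by ring, hcos2, ← ha, ← hA, ← hl] at t2
  rw [show 4 * Real.pi / 5 / 2 = 2 * Real.pi / 5 by ring, hcos4, ← hb, ← hB, ← hl] at t4
  rw [herglotzF_two_fifths_sub_one_eq_integral, integral_kernelTwoFifths_mul_logOneSubSq
    (c := 2 * a - 1) (d := 2 * b - 1) (by linarith) (by linarith) (by linarith) (by linarith),
    t2, t4, logIntegral_neg_one, Real.log_div (by norm_num) (by norm_num), l5, ← hl]
  linear_combination hLi / 2
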